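/- For every τ in the upper half-plane ℍ, δ₂(−1/τ) = τ² δ₁(τ), where δ₁(τ) = (1/8)(θ₂(0,τ)⁴ + θ₃(0,τ)⁴) and δ₂(τ) = −(1/8)(θ₁(0,τ)⁴ + θ₃(0,τ)⁴). -/

import Mathlib

open Complex

noncomputable section

/-- `q^s = e^{2πisτ}`. -/
def qpow (s τ : ℂ) : ℂ := Complex.exp (2 * (Real.pi : ℂ) * Complex.I * s * τ)

/-- The Jacobi theta function `θ(v, τ)`, defined by its infinite product. -/
def jTheta (v τ : ℂ) : ℂ :=
  2 * qpow (1/8) τ * Complex.sin ((Real.pi : ℂ) * v) *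
    ∏' j : ℕ, ((1 - qpow ((j : ℂ) + 1) τ)
      * (1 - Complex.exp (2 * (Real.pi : ℂ) * Complex.I * v) * qpow ((j : ℂ) + 1) τ)
      * (1 - Complex.exp (-(2 * (Real.pi : ℂ) * Complex.I * v)) * qpow ((j : ℂ) + 1) τ))

/-- The Jacobi theta function `θ₁(v, τ)`, defined by its infinite product. -/
def jTheta1 (v τ : ℂ) : ℂ :=
  2 * qpow (1/8) τ * Complex.cos ((Real.pi : ℂ) * v) *
    ∏' j : ℕ, ((1 - qpow ((j : ℂ) + 1) τ)
      * (1 + Complex.exp (2 * (Real.pi : ℂ) * Complex.I * v) * qpow ((j : ℂ) + 1) τ)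
      * (1 + Complex.exp (-(2 * (Real.pi : ℂ) * Complex.I * v)) * qpow ((j : ℂ) + 1) τ))

/-- The Jacobi theta function `θ₂(v, τ)`, defined by its infinite product
(the `j`-th factor involves `q^{j+1-1/2}`). -/
def jTheta2 (v τ : ℂ) : ℂ :=
  ∏' j : ℕ, ((1 - qpow ((j : ℂ) + 1) τ)
    * (1 - Complex.exp (2 * (Real.pi : ℂ) * Complex.I * v) * qpow ((j : ℂ) + 1/2) τ)
    * (1 - Complex.exp (-(2 * (Real.pi : ℂ) * Complex.I * v)) * qpow ((j : ℂ) + 1/2) τ))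

/-- The Jacobi theta function `θ₃(v, τ)`, defined by its infinite product. -/
def jTheta3 (v τ : ℂ) : ℂ :=
  ∏' j : ℕ, ((1 - qpow ((j : ℂ) + 1) τ)
    * (1 + Complex.exp (2 * (Real.pi : ℂ) * Complex.I * v) * qpow ((j : ℂ) + 1/2) τ)
    * (1 + Complex.exp (-(2 * (Real.pi : ℂ) * Complex.I * v)) * qpow ((j : ℂ) + 1/2) τ))

/-- `θ'(0, τ)`: the partial derivative of `θ(v, τ)` in `v`, evaluated at `v = 0`. -/
def jThetaDeriv (τ : ℂ) : ℂ := deriv (fun v => jTheta v τ) 0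

/-- `δ₁(τ) = (1/8)(θ₂(0,τ)⁴ + θ₃(0,τ)⁴)`. -/
def delta1 (τ : ℂ) : ℂ := (1/8) * (jTheta2 0 τ ^ 4 + jTheta3 0 τ ^ 4)

/-- `δ₂(τ) = -(1/8)(θ₁(0,τ)⁴ + θ₃(0,τ)⁴)`. -/
def delta2 (τ : ℂ) : ℂ := -(1/8) * (jTheta1 0 τ ^ 4 + jTheta3 0 τ ^ 4)

/-- The Euler product `∏ (1 - x ^ (n + 1))`. -/
def eulerProd (x : ℂ) : ℂ := ∏' n : ℕ, (1 - x ^ (n + 1))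

lemma multipliable_one_add_mul_pow {x : ℂ} (hx : ‖x‖ < 1) (c : ℂ) {e : ℕ → ℕ}
    (he : e.Injective) : Multipliable fun n : ℕ ↦ 1 + c * x ^ e n := by
  apply multipliable_one_add_of_summable
  simpa using ((summable_geometric_of_lt_one (norm_nonneg x) hx).comp_injective he).mul_left ‖c‖

lemma multipliable_one_sub_pow_comp {x : ℂ} (hx : ‖x‖ < 1) {e : ℕ → ℕ} (he : e.Injective) :
    Multipliable fun n : ℕ ↦ 1 - x ^ e n := by
  simpa [sub_eq_add_neg] using multipliable_one_add_mul_pow hx (-1) he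

lemma multipliable_one_add_pow_comp {x : ℂ} (hx : ‖x‖ < 1) {e : ℕ → ℕ} (he : e.Injective) :
    Multipliable fun n : ℕ ↦ 1 + x ^ e n := by
  simpa using multipliable_one_add_mul_pow hx 1 he

lemma two_mul_add_one_injective : Function.Injective fun j : ℕ ↦ 2 * j + 1 :=
  fun a b h ↦ by simpa using h

lemma norm_sq_lt_one {x : ℂ} (hx : ‖x‖ < 1) : ‖x ^ 2‖ < 1 := by
  rw [norm_pow]
  exact pow_lt_one₀ (norm_nonneg x) hx two_ne_zero

lemma tprod_odd_mul_eulerProd_sq {x : ℂ} (hx : ‖x‖ < 1) :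
    (∏' j : ℕ, (1 - x ^ (2 * j + 1))) * eulerProd (x ^ 2) = eulerProd x := by
  have h := tprod_even_mul_odd (f := fun n : ℕ ↦ 1 - x ^ (n + 1))
    (multipliable_one_sub_pow_comp hx two_mul_add_one_injective)
    (multipliable_one_sub_pow_comp hx (e := fun j ↦ 2 * j + 1 + 1) fun a b h ↦ by simpa using h)
  rw [eulerProd, eulerProd, ← h]
  congr 2
  ext j
  ring

lemma tprod_one_add_pow_mul_eulerProd {x : ℂ} (hx : ‖x‖ < 1) :
    (∏' j : ℕ, (1 + x ^ (j + 1))) * eulerProd x = eulerProd (x ^ 2) := by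
  rw [eulerProd, eulerProd, ← (multipliable_one_add_pow_comp hx (add_left_injective 1)).tprod_mul
    (multipliable_one_sub_pow_comp hx (add_left_injective 1))]
  exact tprod_congr fun j ↦ by ring

lemma tprod_one_add_odd_mul_tprod_odd {x : ℂ} (hx : ‖x‖ < 1) :
    (∏' j : ℕ, (1 + x ^ (2 * j + 1))) * (∏' j : ℕ, (1 - x ^ (2 * j + 1))) =
      ∏' j : ℕ, (1 - (x ^ 2) ^ (2 * j + 1)) := by
  rw [← (multipliable_one_add_pow_comp hx two_mul_add_one_injective).tprod_mul
    (multipliable_one_sub_pow_comp hx two_mul_add_one_injective)]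
  exact tprod_congr fun j ↦ by ring

/-- The nome `e^{πiτ}`, a square root of `q`. -/
def nome (τ : ℂ) : ℂ := Complex.exp (Real.pi * I * τ)

lemma norm_nome_lt_one {τ : ℂ} (hτ : 0 < τ.im) : ‖nome τ‖ < 1 := by
  rw [nome, norm_exp, Real.exp_lt_one_iff]
  simpa using mul_pos Real.pi_pos hτ

lemma qpow_add_one (j : ℕ) (τ : ℂ) : qpow ((j : ℂ) + 1) τ = (nome τ ^ 2) ^ (j + 1) := by
  rw [qpow, nome, ← pow_mul, ← Complex.exp_nat_mul]
  congr 1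
  push_cast
  ring

lemma qpow_add_half (j : ℕ) (τ : ℂ) : qpow ((j : ℂ) + 1 / 2) τ = nome τ ^ (2 * j + 1) := by
  rw [qpow, nome, ← Complex.exp_nat_mul]
  congr 1
  push_cast
  ring

lemma eta_eq_eulerProd (τ : ℂ) :
    ModularForm.eta τ = Complex.exp (Real.pi * I * τ / 12) * eulerProd (nome τ ^ 2) := by
  have h : ∀ n : ℕ, ModularForm.eta_q n τ = (nome τ ^ 2) ^ (n + 1) := fun n ↦ by
    rw [ModularForm.eta_q_eq_cexp, ← qpow_add_one, qpow]
  rw [ModularForm.eta, eulerProd]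
  simp_rw [h, Function.Periodic.qParam]
  congr 2
  push_cast
  ring

lemma nome_two_mul (τ : ℂ) : nome (2 * τ) = nome τ ^ 2 := by
  rw [nome, nome, ← Complex.exp_nat_mul]
  congr 1
  push_cast
  ring

lemma nome_half_sq (τ : ℂ) : nome (τ / 2) ^ 2 = nome τ := by
  rw [← nome_two_mul, mul_div_cancel₀ τ two_ne_zero]

lemma tprod_mul_mul {f g : ℕ → ℂ} (hf : Multipliable f) (hg : Multipliable g) :
    ∏' j, f j * g j * g j = (∏' j, f j) * (∏' j, g j) ^ 2 := by
  rw [(hf.mul hg).tprod_mul hg, hf.tprod_mul hg]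
  ring

lemma jTheta1_zero_mul_eta {τ : ℂ} (hτ : 0 < τ.im) :
    jTheta1 0 τ * ModularForm.eta τ = 2 * ModularForm.eta (2 * τ) ^ 2 := by
  have hx := norm_sq_lt_one (norm_nome_lt_one hτ)
  have h := tprod_one_add_pow_mul_eulerProd hx
  have hexp : qpow (1 / 8) τ * Complex.exp (Real.pi * I * τ / 12) =
      Complex.exp (Real.pi * I * (2 * τ) / 12) ^ 2 := by
    rw [qpow, ← Complex.exp_add, ← Complex.exp_nat_mul]
    congr 1
    push_cast
    ring
  simp only [jTheta1, mul_zero, neg_zero, Complex.exp_zero, one_mul, Complex.cos_zero, mul_one,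
    qpow_add_one]
  rw [tprod_mul_mul (multipliable_one_sub_pow_comp hx (add_left_injective 1))
    (multipliable_one_add_pow_comp hx (add_left_injective 1)), ← eulerProd, eta_eq_eulerProd,
    eta_eq_eulerProd, nome_two_mul, ← h]
  linear_combination 2 * (eulerProd (nome τ ^ 2) * ∏' j : ℕ, (1 + (nome τ ^ 2) ^ (j + 1))) ^ 2 *
    hexp

lemma jTheta2_zero_mul_eta {τ : ℂ} (hτ : 0 < τ.im) :
    jTheta2 0 τ * ModularForm.eta τ = ModularForm.eta (τ / 2) ^ 2 := by
  have hx := norm_nome_lt_one hτ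
  have h := tprod_odd_mul_eulerProd_sq hx
  have hexp : Complex.exp (Real.pi * I * τ / 12) =
      Complex.exp (Real.pi * I * (τ / 2) / 12) ^ 2 := by
    rw [← Complex.exp_nat_mul]
    congr 1
    push_cast
    ring
  simp only [jTheta2, mul_zero, neg_zero, Complex.exp_zero, one_mul, qpow_add_one, qpow_add_half]
  rw [tprod_mul_mul (multipliable_one_sub_pow_comp (norm_sq_lt_one hx) (add_left_injective 1))
    (multipliable_one_sub_pow_comp hx two_mul_add_one_injective), ← eulerProd, eta_eq_eulerProd,
    eta_eq_eulerProd, nome_half_sq, ← h, hexp]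
  ring

lemma jTheta3_zero_mul_eta {τ : ℂ} (hτ : 0 < τ.im) :
    jTheta3 0 τ * (ModularForm.eta (τ / 2) ^ 2 * ModularForm.eta (2 * τ) ^ 2) =
      ModularForm.eta τ ^ 5 := by
  have hx := norm_nome_lt_one hτ
  have h₁ := tprod_odd_mul_eulerProd_sq hx
  have h₂ := tprod_odd_mul_eulerProd_sq (norm_sq_lt_one hx)
  have h₃ := tprod_one_add_odd_mul_tprod_odd hx
  have hexp : Complex.exp (Real.pi * I * (τ / 2) / 12) ^ 2 *
      Complex.exp (Real.pi * I * (2 * τ) / 12) ^ 2 = Complex.exp (Real.pi * I * τ / 12) ^ 5 := by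
    simp only [← Complex.exp_nat_mul, ← Complex.exp_add]
    congr 1
    push_cast
    ring
  simp only [jTheta3, mul_zero, neg_zero, Complex.exp_zero, one_mul, qpow_add_one, qpow_add_half]
  rw [tprod_mul_mul (multipliable_one_sub_pow_comp (norm_sq_lt_one hx) (add_left_injective 1))
    (multipliable_one_add_pow_comp hx two_mul_add_one_injective), ← eulerProd, eta_eq_eulerProd,
    eta_eq_eulerProd, eta_eq_eulerProd, nome_half_sq, nome_two_mul, mul_pow _ _ 5, ← hexp]
  have h : (∏' j : ℕ, (1 + nome τ ^ (2 * j + 1))) * eulerProd (nome τ) *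
      eulerProd ((nome τ ^ 2) ^ 2) = eulerProd (nome τ ^ 2) ^ 2 := by
    rw [← h₁, sq (eulerProd (nome τ ^ 2))]
    nth_rw 3 [← h₂]
    rw [← h₃]
    ring
  rw [show 5 = 1 + 2 * 2 from rfl, pow_add, pow_mul (eulerProd (nome τ ^ 2)), ← h]
  ring

lemma eta_neg_one_div_pow_four {τ : ℂ} (hτ : 0 < τ.im) :
    ModularForm.eta (-1 / τ) ^ 4 = -τ ^ 2 * ModularForm.eta τ ^ 4 := by
  have h : ModularForm.eta (-1 / τ) = (Complex.sqrt I)⁻¹ * (Complex.sqrt τ * ModularForm.eta τ) :=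
    ModularForm.eta_comp_eq_csqrt_I_inv hτ
  have hsqrt (z : ℂ) : Complex.sqrt z ^ 4 = z ^ 2 := by
    rw [Complex.sqrt, ← Complex.cpow_nat_mul]
    norm_num
  rw [h, mul_pow, mul_pow, inv_pow, hsqrt, hsqrt, I_sq]
  ring

/-- The transformation law `δ₂(-1/τ) = τ² δ₁(τ)` for every `τ` in the upper half-plane. -/
theorem delta2_S_transformation (τ : ℂ) (hτ : 0 < τ.im) :
    delta2 (-1 / τ) = τ ^ 2 * delta1 τ := by
  have hτ₀ : τ ≠ 0 := fun h ↦ by simp [h] at hτ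
  have hσ : 0 < (-1 / τ).im := by
    rw [neg_div, one_div, neg_im, inv_im, neg_div, neg_neg]
    exact div_pos hτ (normSq_pos.2 hτ₀)
  have hτ₂ : 0 < (2 * τ).im := by simpa using hτ
  have hτh : 0 < (τ / 2).im := by simpa using hτ
  have ha := eta_neg_one_div_pow_four hτ
  have hb : ModularForm.eta (2 * (-1 / τ)) ^ 4 =
      -(τ / 2) ^ 2 * ModularForm.eta (τ / 2) ^ 4 := by
    rw [show 2 * (-1 / τ) = -1 / (τ / 2) by field_simp]
    exact eta_neg_one_div_pow_four hτh
  have hc : ModularForm.eta (-1 / τ / 2) ^ 4 =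
      -(2 * τ) ^ 2 * ModularForm.eta (2 * τ) ^ 4 := by
    rw [show -1 / τ / 2 = -1 / (2 * τ) by field_simp]
    exact eta_neg_one_div_pow_four hτ₂
  have hea := ModularForm.eta_ne_zero hτ
  have heb := ModularForm.eta_ne_zero hτh
  have hec := ModularForm.eta_ne_zero hτ₂
  have h₁ := congrArg (· ^ 4) (jTheta1_zero_mul_eta hσ)
  have h₂ := congrArg (· ^ 4) (jTheta2_zero_mul_eta hτ)
  have h₃ := congrArg (· ^ 4) (jTheta3_zero_mul_eta hτ)
  have h₃' := congrArg (· ^ 4) (jTheta3_zero_mul_eta hσ)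
  simp only [mul_pow, pow_right_comm _ _ 4, ha, hb, hc] at h₁ h₂ h₃ h₃'
  have h12 : jTheta1 0 (-1 / τ) ^ 4 = -τ ^ 2 * jTheta2 0 τ ^ 4 := by
    apply mul_right_cancel₀ (mul_ne_zero (pow_ne_zero 2 hτ₀) (pow_ne_zero 4 hea))
    linear_combination -h₁ + τ ^ 4 * h₂
  have h33 : jTheta3 0 (-1 / τ) ^ 4 = -τ ^ 2 * jTheta3 0 τ ^ 4 := by
    apply mul_right_cancel₀ (mul_ne_zero (pow_ne_zero 8 hτ₀)
      (mul_ne_zero (pow_ne_zero 8 heb) (pow_ne_zero 8 hec)))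
    linear_combination h₃' + τ ^ 10 * h₃
  rw [delta2, delta1, h12, h33]
  ring
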